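/- Let X₁, …, X_N be C_b^∞-vector fields on ℝ^d; for α ∈ J_r^+(N) let a_α : ℝ^d → ℝ^d be the coefficient map of the iterated commutator X_{[α]} (so X_{[α]} = Σ_{k=1}^d a_{α,k} ∂_k), and for a fixed integer r ≥ 1 define the symmetric positive semidefinite matrix C^{(r)}(x) by c^{(r)}_{ij}(x) = Σ_{α ∈ J_r^+(N)} a_{α,i}(x) a_{α,j}(x). Then the following five statements are equivalent: (I) X₁,…,X_N satisfy the uniform Hörmander condition of order r; (II) there exists σ > 0 such that Σ_{i,j=1}^d c^{(r)}_{ij}(x) ξ_i ξ_j ≥ σ |ξ|² for all x ∈ ℝ^d and ξ ∈ ℝ^d; (III) there exists M > 0 such that for every x ∈ ℝ^d and every i ∈ {1,…,d} there are reals λ_α ∈ [−M,M] (α ∈ J_r^+(N)) with e_i = Σ_{α ∈ J_r^+(N)} λ_α a_α(x), where e_i is the i-th standard unit vector; (IV) there exists σ > 0 such that the Lebesgue measure of the set { Σ_{α ∈ J_r^+(N)} λ_α a_α(x) : |λ_α| ≤ 1 for all α ∈ J_r^+(N) } ⊆ ℝ^d is at least σ for every x ∈ ℝ^d; (V) there exists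 σ > 0 such that for every x ∈ ℝ^d there are multi-indices α₁, …, α_d ∈ J_r^+(N) with |det(a_{α₁}(x), …, a_{α_d}(x))| ≥ σ. -/

import Mathlib

open MeasureTheory Complex Real Finset

noncomputable section

/-- Euclidean space `ℝ^d`. -/
abbrev Ec (d : ℕ) := EuclideanSpace ℝ (Fin d)

variable {d : ℕ}

/-- The `L²` norm of a complex-valued function. -/
def l2norm (f : Ec d → ℂ) : ℝ := (∫ x, ‖f x‖ ^ 2).sqrt

/-- Smooth compactly supported test functions. -/
def IsCc (φ : Ec d → ℂ) : Prop := ContDiff ℝ (⊤ : ℕ∞) φ ∧ HasCompactSupport φ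

/-- A `C_b^∞`-vector field on `ℝ^d`: a smooth coefficient map `a : ℝ^d → ℝ^d` which is
bounded together with all its derivatives. -/
def IsCbVF (a : Ec d → Ec d) : Prop :=
  ContDiff ℝ (⊤ : ℕ∞) a ∧ ∀ n : ℕ, ∃ C : ℝ, ∀ x, ‖iteratedFDeriv ℝ n a x‖ ≤ C

/-- `f` is the (smooth, globally defined) flow `f t x = exp(tX)(x)` of the vector field
with coefficient map `a`:  `f 0 x = x` and `∂_t f t x = a (f t x)`. -/
def IsFlowOf (a : Ec d → Ec d) (f : ℝ → Ec d → Ec d) : Prop :=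
  ContDiff ℝ (⊤ : ℕ∞) (fun p : ℝ × Ec d => f p.1 p.2) ∧
    (∀ x, f 0 x = x) ∧
    ∀ t x, HasDerivAt (fun s => f s x) (a (f t x)) t

/-- A smooth real-valued function which is bounded together with all its derivatives. -/
def IsCbR (ψ : Ec d → ℝ) : Prop :=
  ContDiff ℝ (⊤ : ℕ∞) ψ ∧ ∀ n : ℕ, ∃ C : ℝ, ∀ x, ‖iteratedFDeriv ℝ n ψ x‖ ≤ C

/-- The commutator `[X,Y]` of vector fields, as coefficient maps:
`[X,Y] = ∑_k (X b_k - Y a_k) ∂_k`. -/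
def vfComm (a b : Ec d → Ec d) : Ec d → Ec d :=
  fun x => fderiv ℝ b x (a x) - fderiv ℝ a x (b x)

/-- The iterated commutator `X_{[α]} = [X_{i₁},[X_{i₂},…,[X_{i_{n-1}},X_{i_n}]…]]`
associated with a multi-index `α` given as a list. -/
def multiComm {ι : Type*} (X : ι → Ec d → Ec d) : List ι → (Ec d → Ec d)
  | [] => fun _ => 0
  | [i] => X i
  | i :: j :: l => vfComm (X i) (multiComm X (j :: l))

/-- The uniform Hörmander condition of order `r`: every `C_b^∞`-vector field is a
`C_b^∞(ℝ^d)`-linear combination of the multi-commutators `X_{[α]}` with `1 ≤ |α| ≤ r`. -/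
def UniformHormander {d N : ℕ} (X : Fin N → Ec d → Ec d) (r : ℕ) : Prop :=
  ∀ a : Ec d → Ec d, IsCbVF a →
    ∃ ψ : List (Fin N) → (Ec d → ℝ), (∀ l, IsCbR (ψ l)) ∧
      ∀ x, a x = ∑ k ∈ Finset.Icc 1 r, ∑ v : Fin k → Fin N,
        ψ (List.ofFn v) x • multiComm X (List.ofFn v) x

/-- The matrix `C^{(r)}(x)` with entries
`c^{(r)}_{ij}(x) = ∑_{α ∈ J_r^+(N)} a_{α,i}(x) a_{α,j}(x)`, where `a_α` is the
coefficient map of the multi-commutator `X_{[α]}`. -/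
def Cmat {d N : ℕ} (X : Fin N → Ec d → Ec d) (r : ℕ) (x : Ec d) (i j : Fin d) : ℝ :=
  ∑ k ∈ Finset.Icc 1 r, ∑ v : Fin k → Fin N,
    multiComm X (List.ofFn v) x i * multiComm X (List.ofFn v) x j

open scoped RealInnerProductSpace

section BoundedDerivatives

variable {E F G H : Type*} [NormedAddCommGroup E] [NormedSpace ℝ E]
  [NormedAddCommGroup F] [NormedSpace ℝ F] [NormedAddCommGroup G] [NormedSpace ℝ G]
  [NormedAddCommGroup H] [NormedSpace ℝ H]

/-- The derivatives of `f` of order at most `n` are bounded. -/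
def BddDerivUpTo (n : ℕ) (f : E → F) : Prop :=
  ∀ k ≤ n, ∃ C : ℝ, ∀ x, ‖iteratedFDeriv ℝ k f x‖ ≤ C

/-- `f` is smooth and bounded together with all its derivatives. -/
def SmoothBdd (f : E → F) : Prop :=
  ContDiff ℝ (⊤ : ℕ∞) f ∧ ∀ n : ℕ, ∃ C : ℝ, ∀ x, ‖iteratedFDeriv ℝ n f x‖ ≤ C

lemma SmoothBdd.bddDerivUpTo {f : E → F} (hf : SmoothBdd f) (n : ℕ) : BddDerivUpTo n f :=
  fun k _ => hf.2 k

lemma SmoothBdd.exists_norm_le {f : E → F} (hf : SmoothBdd f) : ∃ C : ℝ, ∀ x, ‖f x‖ ≤ C := by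
  obtain ⟨C, hC⟩ := hf.2 0
  exact ⟨C, fun x => by simpa using hC x⟩

lemma BddDerivUpTo.bilinear (B : F →L[ℝ] G →L[ℝ] H) {n : ℕ} {f : E → F} {g : E → G}
    (hfs : ContDiff ℝ (⊤ : ℕ∞) f) (hgs : ContDiff ℝ (⊤ : ℕ∞) g)
    (hf : BddDerivUpTo n f) (hg : BddDerivUpTo n g) :
    BddDerivUpTo n (fun x => B (f x) (g x)) := by
  intro k hk
  choose! Cf hCf using hf
  choose! Cg hCg using hg
  refine ⟨‖B‖ * ∑ i ∈ Finset.range (k + 1), (k.choose i : ℝ) * Cf i * Cg (k - i), fun x => ?_⟩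
  refine (B.norm_iteratedFDeriv_le_of_bilinear hfs hgs x
    (n := k) (by exact_mod_cast le_top)).trans ?_
  gcongr with i hi
  · exact mul_nonneg (Nat.cast_nonneg _) ((norm_nonneg _).trans (hCf i (by grind) x))
  · exact hCf i (by grind) x
  · exact hCg (k - i) (by grind) x

lemma SmoothBdd.bilinear (B : F →L[ℝ] G →L[ℝ] H) {f : E → F} {g : E → G}
    (hf : SmoothBdd f) (hg : SmoothBdd g) : SmoothBdd (fun x => B (f x) (g x)) :=
  ⟨B.isBoundedBilinearMap.contDiff.comp (hf.1.prodMk hg.1), fun n =>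
    BddDerivUpTo.bilinear B hf.1 hg.1 (hf.bddDerivUpTo n) (hg.bddDerivUpTo n) n le_rfl⟩

lemma SmoothBdd.const (c : F) : SmoothBdd (fun _ : E => c) := by
  refine ⟨contDiff_const, fun n => ?_⟩
  rcases n with _ | n
  · exact ⟨‖c‖, fun x => by simp⟩
  · exact ⟨0, fun x => by simp [iteratedFDeriv_succ_const]⟩

lemma SmoothBdd.add {f g : E → F} (hf : SmoothBdd f) (hg : SmoothBdd g) :
    SmoothBdd (fun x => f x + g x) := by
  refine ⟨hf.1.add hg.1, fun n => ?_⟩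
  obtain ⟨C, hC⟩ := hf.2 n
  obtain ⟨D, hD⟩ := hg.2 n
  refine ⟨C + D, fun x => ?_⟩
  rw [fun_iteratedFDeriv_add_apply
    (hf.1.contDiffAt.of_le (by exact_mod_cast le_top))
    (hg.1.contDiffAt.of_le (by exact_mod_cast le_top))]
  exact (norm_add_le _ _).trans (add_le_add (hC x) (hD x))

lemma SmoothBdd.neg {f : E → F} (hf : SmoothBdd f) : SmoothBdd (fun x => -f x) := by
  refine ⟨hf.1.neg, fun n => ?_⟩
  obtain ⟨C, hC⟩ := hf.2 n
  refine ⟨C, fun x => ?_⟩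
  have : (fun x => -f x) = -f := rfl
  rw [this, iteratedFDeriv_neg_apply, norm_neg]
  exact hC x

lemma SmoothBdd.sum {ι : Type*} (S : Finset ι) {f : ι → E → F}
    (hf : ∀ i ∈ S, SmoothBdd (f i)) : SmoothBdd (fun x => ∑ i ∈ S, f i x) := by
  classical
  induction S using Finset.induction_on with
  | empty => simpa using SmoothBdd.const (0 : F)
  | insert i S hi ih =>
    simp only [Finset.sum_insert hi]
    exact (hf i (by simp)).add (ih fun j hj => hf j (by simp [hj]))

lemma SmoothBdd.fderiv {f : E → F} (hf : SmoothBdd f) : SmoothBdd (fderiv ℝ f) := by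
  refine ⟨hf.1.fderiv_right (by simp), fun n => ?_⟩
  obtain ⟨C, hC⟩ := hf.2 (n + 1)
  exact ⟨C, fun x => by rw [norm_iteratedFDeriv_fderiv]; exact hC x⟩

section RingInverse

variable {R : Type*} [NormedRing R] [NormedAlgebra ℝ R] [CompleteSpace R] {f : E → R}

lemma ContDiff.ringInverse_of_isUnit (hf : ContDiff ℝ (⊤ : ℕ∞) f) (hu : ∀ x, IsUnit (f x)) :
    ContDiff ℝ (⊤ : ℕ∞) (fun x => Ring.inverse (f x)) := by
  rw [contDiff_iff_contDiffAt]
  intro x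
  obtain ⟨u, hux⟩ := hu x
  have := contDiffAt_ringInverse ℝ (n := (⊤ : ℕ∞)) u
  rw [hux] at this
  exact this.comp x hf.contDiffAt

lemma fderiv_ringInverse_comp (hf : Differentiable ℝ f) (hu : ∀ x, IsUnit (f x)) :
    _root_.fderiv ℝ (fun x => Ring.inverse (f x)) = fun x =>
      ContinuousLinearMap.compL ℝ E R R
        (ContinuousLinearMap.mulLeftRight ℝ R (Ring.inverse (f x)) (Ring.inverse (f x)))
        (-_root_.fderiv ℝ f x) := by
  funext x
  obtain ⟨u, hux⟩ := hu x
  have h1 := hasFDerivAt_ringInverse (𝕜 := ℝ) u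
  rw [hux] at h1
  have h2 := h1.comp x (hf x).hasFDerivAt
  have h3 : (↑u⁻¹ : R) = Ring.inverse (f x) := by rw [← hux, Ring.inverse_unit]
  rw [h3] at h2
  refine h2.fderiv.trans ?_
  ext v
  simp

/-- Pointwise inversion in a Banach algebra preserves smoothness with bounded derivatives, as
soon as the inverses are bounded. -/
lemma SmoothBdd.ringInverse (hf : SmoothBdd f) (hu : ∀ x, IsUnit (f x)) {C : ℝ}
    (hC : ∀ x, ‖Ring.inverse (f x)‖ ≤ C) : SmoothBdd (fun x => Ring.inverse (f x)) := by
  obtain ⟨g, hg⟩ : ∃ g : E → R, g = fun x => Ring.inverse (f x) := ⟨_, rfl⟩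
  have hsm : ContDiff ℝ (⊤ : ℕ∞) g := hg ▸ hf.1.ringInverse_of_isUnit hu
  have hfd : _root_.fderiv ℝ g = fun x => ContinuousLinearMap.compL ℝ E R R
      (ContinuousLinearMap.mulLeftRight ℝ R (g x) (g x)) (-_root_.fderiv ℝ f x) := by
    rw [hg]
    exact fderiv_ringInverse_comp (hf.1.differentiable (by simp)) hu
  have hC' : ∀ x, ‖g x‖ ≤ C := fun x => by rw [hg]; exact hC x
  rw [← hg]
  have hs : ContDiff ℝ (⊤ : ℕ∞) (fun x => ContinuousLinearMap.mulLeftRight ℝ R (g x) (g x)) :=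
    (ContinuousLinearMap.mulLeftRight ℝ R).isBoundedBilinearMap.contDiff.comp (hsm.prodMk hsm)
  have hb : ∀ n, BddDerivUpTo n g := by
    intro n
    induction n with
    | zero =>
      intro k hk
      obtain rfl : k = 0 := by omega
      exact ⟨C, fun x => by simpa using hC' x⟩
    | succ n ih =>
      intro k hk
      rcases hk.lt_or_eq with hk | rfl
      · exact ih k (by omega)
      · have h1 : BddDerivUpTo n (fun x => ContinuousLinearMap.mulLeftRight ℝ R (g x) (g x)) :=
          BddDerivUpTo.bilinear (ContinuousLinearMap.mulLeftRight ℝ R) hsm hsm ih ih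
        have h2 : BddDerivUpTo n (_root_.fderiv ℝ g) := by
          rw [hfd]
          exact BddDerivUpTo.bilinear (ContinuousLinearMap.compL ℝ E R R) hs
            hf.fderiv.neg.1 h1 (hf.fderiv.neg.bddDerivUpTo n)
        obtain ⟨D, hD⟩ := h2 n le_rfl
        exact ⟨D, fun x => by rw [← norm_iteratedFDeriv_fderiv]; exact hD x⟩
  exact ⟨hsm, fun n => hb n n le_rfl⟩

end RingInverse

end BoundedDerivatives

lemma IsCbVF.vfComm {a b : Ec d → Ec d} (ha : IsCbVF a) (hb : IsCbVF b) :
    IsCbVF (vfComm a b) := by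
  have ha' : SmoothBdd a := ha
  have hb' : SmoothBdd b := hb
  have h := (hb'.fderiv.bilinear (ContinuousLinearMap.id ℝ (Ec d →L[ℝ] Ec d)) ha').add
    (ha'.fderiv.bilinear (ContinuousLinearMap.id ℝ (Ec d →L[ℝ] Ec d)) hb').neg
  have h' : SmoothBdd (_root_.vfComm a b) := by
    convert h using 2
    simp [_root_.vfComm, sub_eq_add_neg]
  exact h'

lemma IsCbVF.multiComm {ι : Type*} {X : ι → Ec d → Ec d} (hX : ∀ i, IsCbVF (X i)) :
    ∀ l : List ι, IsCbVF (multiComm X l)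
  | [] => SmoothBdd.const (0 : Ec d)
  | [i] => hX i
  | i :: j :: l => (hX i).vfComm (IsCbVF.multiComm hX (j :: l))

section Pointwise

/-- The determinant of the matrix with columns `v j`. -/
def colDet (v : Fin d → Ec d) : ℝ := (Matrix.of fun i j : Fin d => v j i).det

lemma colDet_eq_detRowAlternating (v : Fin d → Ec d) :
    colDet v = Matrix.detRowAlternating (R := ℝ) (fun j => WithLp.ofLp (v j)) := by
  rw [colDet, ← Matrix.det_transpose]
  rfl

lemma eq_sum_colDet_update_smul (v : Fin d → Ec d) (hv : colDet v ≠ 0) (y : Ec d) :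
    y = ∑ i, (colDet (Function.update v i y) / colDet v) • v i := by
  have h := Matrix.mulVec_cramer (Matrix.of fun i j : Fin d => v j i) (WithLp.ofLp y)
  have hc : ∀ i, (Matrix.of fun i j : Fin d => v j i).cramer (WithLp.ofLp y) i =
      colDet (Function.update v i y) := by
    intro i
    rw [Matrix.cramer_apply, colDet]
    congr 1
    ext k j
    by_cases hj : j = i
    · subst hj; simp
    · simp [hj]
  ext k
  have hk := congrFun h k
  simp only [Matrix.mulVec, dotProduct, Matrix.of_apply, hc, Pi.smul_apply, smul_eq_mul] at hk
  rw [WithLp.ofLp_sum, Finset.sum_apply]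
  simp only [PiLp.smul_apply, smul_eq_mul]
  rw [← mul_right_inj' hv, show colDet v * y k = _ from hk.symm, Finset.mul_sum]
  refine Finset.sum_congr rfl fun i _ => ?_
  field_simp

variable {ι : Type*}

lemma one_eq_sum_prod_mul_colDet [DecidableEq ι] (S : Finset ι) (w : ι → Ec d)
    (c : Fin d → ι → ℝ)
    (h : ∀ i, (EuclideanSpace.single i 1 : Ec d) = ∑ l ∈ S, c i l • w l) :
    1 = ∑ β ∈ Fintype.piFinset (fun _ : Fin d => S),
      (∏ i, c i (β i)) * colDet (fun i => w (β i)) := by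
  have h1 : colDet (fun i => (EuclideanSpace.single i 1 : Ec d)) = 1 := by
    rw [colDet, ← Matrix.det_one (n := Fin d) (R := ℝ)]
    congr 1
    ext i j
    simp [Matrix.one_apply]
  have h2 : ∀ i, WithLp.ofLp (EuclideanSpace.single i 1 : Ec d) =
      ∑ l ∈ S, c i l • WithLp.ofLp (w l) := fun i => by
    rw [h i, WithLp.ofLp_sum]
    rfl
  rw [← h1, colDet_eq_detRowAlternating]
  simp only [h2]
  have h3 := (Matrix.detRowAlternating (R := ℝ) (n := Fin d)).toMultilinearMap.map_sum_finset
    (fun i l => c i l • WithLp.ofLp (w l)) (fun _ => S)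
  refine h3.trans (Finset.sum_congr rfl fun β _ => ?_)
  rw [colDet_eq_detRowAlternating]
  exact (Matrix.detRowAlternating (R := ℝ) (n := Fin d)).toMultilinearMap.map_smul_univ
    (fun i => c i (β i)) (fun i => WithLp.ofLp (w (β i)))

lemma exists_sum_smul_of_subfamily (S : Finset ι) (w : ι → Ec d)
    (β : Fin d → ι) (hβ : ∀ i, β i ∈ S) (t : Fin d → ℝ) {M : ℝ} (ht : ∑ i, |t i| ≤ M) :
    ∃ c : ι → ℝ, (∀ l, |c l| ≤ M) ∧ ∑ i, t i • w (β i) = ∑ l ∈ S, c l • w l := by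
  classical
  refine ⟨fun l => ∑ i, if β i = l then t i else 0, fun l => ?_, ?_⟩
  · refine (Finset.abs_sum_le_sum_abs _ _).trans (le_trans ?_ ht)
    refine Finset.sum_le_sum fun i _ => ?_
    split_ifs <;> simp
  · simp only [Finset.sum_smul, ite_smul, zero_smul]
    rw [Finset.sum_comm]
    refine Finset.sum_congr rfl fun i _ => ?_
    rw [Finset.sum_ite_eq, if_pos (hβ i)]

lemma abs_colDet_le (v : Fin d → Ec d) {K : ℝ} (hK : ∀ j, ‖v j‖ ≤ K) :
    |colDet v| ≤ (d.factorial : ℝ) * K ^ d := by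
  have h := Matrix.det_le (A := Matrix.of fun i j : Fin d => v j i)
    (abv := IsAbsoluteValue.toAbsoluteValue (abs : ℝ → ℝ)) (x := K)
    (fun i j => (PiLp.norm_apply_le (v j) i).trans (hK j))
  simpa [colDet] using h

/-- The linear map `z ↦ ∑ i, z i • v i` multiplies Lebesgue measure by `|det v|`. -/
lemma volume_image_toEuclideanLin (v : Fin d → Ec d) (s : Set (Ec d)) :
    volume ((Matrix.toEuclideanLin (Matrix.of fun i j : Fin d => v j i)) '' s) =
      ENNReal.ofReal |colDet v| * volume s := by
  rw [Measure.addHaar_image_linearMap, Matrix.toEuclideanLin_eq_toLin_orthonormal,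
    LinearMap.det_toLin]
  rfl

lemma toEuclideanLin_apply_eq_sum (v : Fin d → Ec d) (z : Ec d) :
    Matrix.toEuclideanLin (Matrix.of fun i j : Fin d => v j i) z = ∑ i, z i • v i := by
  ext k
  rw [Matrix.toLpLin_apply, WithLp.ofLp_sum, Finset.sum_apply]
  simp [Matrix.mulVec, dotProduct, mul_comm]

/-- The zonotope spanned by the vectors `w l`, `l ∈ S`. -/
def zonotope (S : Finset ι) (w : ι → Ec d) : Set (Ec d) :=
  {y | ∃ c : ι → ℝ, (∀ l, |c l| ≤ 1) ∧ y = ∑ l ∈ S, c l • w l}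

lemma ofReal_abs_colDet_mul_le_volume_zonotope (S : Finset ι) (w : ι → Ec d)
    (β : Fin d → ι) (hβ : ∀ i, β i ∈ S) :
    ENNReal.ofReal |colDet fun i => w (β i)| *
      volume (Metric.closedBall (0 : Ec d) (1 / (d + 1))) ≤ volume (zonotope S w) := by
  rw [← volume_image_toEuclideanLin]
  refine measure_mono ?_
  rintro _ ⟨z, hz, rfl⟩
  rw [toEuclideanLin_apply_eq_sum]
  rw [mem_closedBall_zero_iff] at hz
  refine exists_sum_smul_of_subfamily S w β hβ (fun i => z i) ?_
  calc ∑ i, |z i| ≤ ∑ _i : Fin d, (1 / (d + 1) : ℝ) :=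
        Finset.sum_le_sum fun i _ => (PiLp.norm_apply_le z i).trans hz
    _ ≤ 1 := by
        rw [Finset.sum_const, Finset.card_univ, Fintype.card_fin, nsmul_eq_mul, mul_one_div,
          div_le_one (by positivity)]
        linarith

lemma volume_zonotope_eq_zero (S : Finset ι) (w : ι → Ec d)
    (h : ∀ β : Fin d → ι, (∀ i, β i ∈ S) → colDet (fun i => w (β i)) = 0) :
    volume (zonotope S w) = 0 := by
  classical
  have hne : Submodule.span ℝ (w '' (S : Set ι)) ≠ ⊤ := by
    intro htop
    have hc : ∀ i : Fin d, ∃ c : ι → ℝ,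
        ∑ l ∈ S, c l • w l = (EuclideanSpace.single i 1 : Ec d) := fun i =>
      (Submodule.mem_span_image_finset_iff_exists_fun' ℝ).1 (htop ▸ Submodule.mem_top)
    choose c hc using hc
    have h1 := one_eq_sum_prod_mul_colDet S w c fun i => (hc i).symm
    rw [Finset.sum_eq_zero] at h1
    · exact one_ne_zero h1
    · intro β hβ
      rw [h β (by simpa using hβ), mul_zero]
  refine measure_mono_null ?_ (Measure.addHaar_submodule volume _ hne)
  rintro _ ⟨c, -, rfl⟩
  exact Submodule.sum_mem _ fun l hl =>
    Submodule.smul_mem _ _ (Submodule.subset_span ⟨l, hl, rfl⟩)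

lemma exists_volume_zonotope_le (S : Finset ι) (w : ι → Ec d) (hpos : 0 < volume (zonotope S w)) :
    ∃ β : Fin d → ι, (∀ i, β i ∈ S) ∧ volume (zonotope S w) ≤
      ENNReal.ofReal |colDet fun i => w (β i)| *
        volume (Metric.closedBall (0 : Ec d) √(d * (S.card : ℝ) ^ 2)) := by
  classical
  obtain ⟨β₀, hβ₀, hne⟩ : ∃ β : Fin d → ι, (∀ i, β i ∈ S) ∧ colDet (fun i => w (β i)) ≠ 0 := by
    by_contra! hcon
    exact hpos.ne' (volume_zonotope_eq_zero S w hcon)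
  obtain ⟨β, hβ, hmax⟩ := Finset.exists_max_image (Fintype.piFinset fun _ : Fin d => S)
    (fun β => |colDet fun i => w (β i)|) ⟨β₀, by simpa using hβ₀⟩
  simp only [Fintype.mem_piFinset] at hβ hmax
  have hpos' : 0 < |colDet fun i => w (β i)| := (abs_pos.2 hne).trans_le (hmax β₀ hβ₀)
  refine ⟨β, hβ, ?_⟩
  rw [← volume_image_toEuclideanLin]
  refine measure_mono ?_
  rintro _ ⟨c, hc, rfl⟩
  let t : ι → Fin d → ℝ := fun l i =>
    colDet (Function.update (fun i => w (β i)) i (w l)) / colDet fun i => w (β i)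
  have ht : ∀ l ∈ S, ∀ i, |t l i| ≤ 1 := by
    intro l hl i
    rw [abs_div, div_le_one hpos']
    have hup : Function.update (fun i => w (β i)) i (w l) =
        fun j => w (Function.update β i l j) := by
      ext1 j
      by_cases hj : j = i
      · subst hj; simp
      · simp [hj]
    rw [hup]
    refine hmax _ fun j => ?_
    by_cases hj : j = i
    · subst hj; simpa using hl
    · simpa [hj] using hβ j
  refine ⟨WithLp.toLp 2 fun i => ∑ l ∈ S, c l * t l i, ?_, ?_⟩
  · rw [mem_closedBall_zero_iff, EuclideanSpace.norm_eq]
    refine Real.sqrt_le_sqrt ?_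
    have hle : ∀ i, |∑ l ∈ S, c l * t l i| ≤ S.card := fun i => by
      refine (Finset.abs_sum_le_sum_abs _ _).trans ?_
      refine (Finset.sum_le_sum (g := fun _ => (1 : ℝ)) fun l hl => ?_).trans (by simp)
      rw [abs_mul]
      exact mul_le_one₀ (hc l) (abs_nonneg _) (ht l hl i)
    calc _ ≤ ∑ _i : Fin d, (S.card : ℝ) ^ 2 :=
          Finset.sum_le_sum fun i _ => pow_le_pow_left₀ (norm_nonneg _) (hle i) 2
      _ = d * (S.card : ℝ) ^ 2 := by simp
  · rw [toEuclideanLin_apply_eq_sum]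
    simp only [Finset.sum_smul, mul_smul]
    rw [Finset.sum_comm]
    refine Finset.sum_congr rfl fun l _ => ?_
    rw [← Finset.smul_sum]
    congr 1
    exact (eq_sum_colDet_update_smul _ (abs_pos.1 hpos') (w l)).symm

end Pointwise

section Families

variable {ι : Type*} (S : Finset ι) (A : ι → Ec d → Ec d)

lemma exists_bounded_coeffs_of_hormander
    (h : ∀ a : Ec d → Ec d, IsCbVF a → ∃ ψ : ι → Ec d → ℝ, (∀ l, IsCbR (ψ l)) ∧
      ∀ x, a x = ∑ l ∈ S, ψ l x • A l x) :
    ∃ M : ℝ, 0 < M ∧ ∀ (x : Ec d) (i : Fin d), ∃ c : ι → ℝ, (∀ l, |c l| ≤ M) ∧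
      (EuclideanSpace.single i 1 : Ec d) = ∑ l ∈ S, c l • A l x := by
  classical
  choose ψ hψ hsum using fun i : Fin d => h (fun _ => EuclideanSpace.single i 1) (SmoothBdd.const _)
  choose C hC using fun i l => SmoothBdd.exists_norm_le (hψ i l)
  have hC0 : ∀ i l, 0 ≤ C i l := fun i l => (norm_nonneg _).trans (hC i l 0)
  have hM : 0 < (∑ i, ∑ l ∈ S, C i l) + 1 := by
    have : 0 ≤ ∑ i, ∑ l ∈ S, C i l :=
      Finset.sum_nonneg fun i _ => Finset.sum_nonneg fun l _ => hC0 i l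
    linarith
  refine ⟨_, hM, fun x i => ⟨fun l => if l ∈ S then ψ i l x else 0, fun l => ?_, ?_⟩⟩
  · beta_reduce
    split_ifs with hl
    · have h1 : C i l ≤ ∑ l ∈ S, C i l :=
        Finset.single_le_sum (f := fun l => C i l) (fun l _ => hC0 i l) hl
      have h2 : ∑ l ∈ S, C i l ≤ ∑ i, ∑ l ∈ S, C i l :=
        Finset.single_le_sum (f := fun i => ∑ l ∈ S, C i l)
          (fun i _ => Finset.sum_nonneg fun l _ => hC0 i l) (Finset.mem_univ i)
      have h3 : |ψ i l x| ≤ C i l := hC i l x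
      linarith
    · simpa using hM.le
  · rw [hsum i x]
    exact Finset.sum_congr rfl fun l hl => by simp [hl]

lemma exists_gram_lower_bound_of_bounded_coeffs
    (h : ∃ M : ℝ, 0 < M ∧ ∀ (x : Ec d) (i : Fin d), ∃ c : ι → ℝ, (∀ l, |c l| ≤ M) ∧
      (EuclideanSpace.single i 1 : Ec d) = ∑ l ∈ S, c l • A l x) :
    ∃ σ : ℝ, 0 < σ ∧ ∀ x ξ : Ec d, σ * ‖ξ‖ ^ 2 ≤ ∑ l ∈ S, ⟪A l x, ξ⟫ ^ 2 := by
  obtain ⟨M, hM, h⟩ := h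
  have hpos : 0 < (d * (S.card * M ^ 2) + 1 : ℝ) := by positivity
  refine ⟨1 / (d * (S.card * M ^ 2) + 1), by positivity, fun x ξ => ?_⟩
  rw [one_div_mul_eq_div, div_le_iff₀ hpos]
  have hQ : 0 ≤ ∑ l ∈ S, ⟪A l x, ξ⟫ ^ 2 := Finset.sum_nonneg fun l _ => sq_nonneg _
  have hcoord : ∀ i, ξ i ^ 2 ≤ S.card * M ^ 2 * ∑ l ∈ S, ⟪A l x, ξ⟫ ^ 2 := by
    intro i
    obtain ⟨c, hc, hsum⟩ := h x i
    have h1 : ξ i = ∑ l ∈ S, c l * ⟪A l x, ξ⟫ := by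
      have : ⟪(EuclideanSpace.single i 1 : Ec d), ξ⟫ = ξ i := by
        simp [EuclideanSpace.inner_single_left]
      rw [← this, hsum, sum_inner]
      simp only [real_inner_smul_left]
    calc ξ i ^ 2 ≤ (∑ l ∈ S, c l ^ 2) * ∑ l ∈ S, ⟪A l x, ξ⟫ ^ 2 := by
          rw [h1]; exact Finset.sum_mul_sq_le_sq_mul_sq _ _ _
      _ ≤ (∑ _l ∈ S, M ^ 2) * ∑ l ∈ S, ⟪A l x, ξ⟫ ^ 2 := by
          gcongr ?_ * _
          exact Finset.sum_le_sum fun l _ =>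
            sq_le_sq' (abs_le.1 (hc l)).1 (abs_le.1 (hc l)).2
      _ = _ := by simp
  calc ‖ξ‖ ^ 2 = ∑ i, ξ i ^ 2 := EuclideanSpace.real_norm_sq_eq ξ
    _ ≤ ∑ _i : Fin d, S.card * M ^ 2 * ∑ l ∈ S, ⟪A l x, ξ⟫ ^ 2 :=
        Finset.sum_le_sum fun i _ => hcoord i
    _ = d * (S.card * M ^ 2) * ∑ l ∈ S, ⟪A l x, ξ⟫ ^ 2 := by
        rw [Finset.sum_const, Finset.card_univ, Fintype.card_fin, nsmul_eq_mul]; ring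
    _ ≤ _ := by nlinarith

lemma hormander_of_gram_lower_bound (hA : ∀ l, IsCbVF (A l))
    (h : ∃ σ : ℝ, 0 < σ ∧ ∀ x ξ : Ec d, σ * ‖ξ‖ ^ 2 ≤ ∑ l ∈ S, ⟪A l x, ξ⟫ ^ 2)
    (a : Ec d → Ec d) (ha : IsCbVF a) :
    ∃ ψ : ι → Ec d → ℝ, (∀ l, IsCbR (ψ l)) ∧ ∀ x, a x = ∑ l ∈ S, ψ l x • A l x := by
  obtain ⟨σ, hσ, h⟩ := h
  have hA' : ∀ l, SmoothBdd (A l) := hA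
  have ha' : SmoothBdd a := ha
  let I : Ec d →L[ℝ] Ec d →L[ℝ] ℝ := innerSL ℝ
  let T : Ec d → Ec d →L[ℝ] Ec d := fun x => ∑ l ∈ S, (I (A l x)).smulRight (A l x)
  have hTapp : ∀ x y, T x y = ∑ l ∈ S, ⟪A l x, y⟫ • A l x := fun x y => by
    simp only [T, _root_.sum_apply, ContinuousLinearMap.smulRight_apply]
    rfl
  have hT : SmoothBdd T := by
    refine SmoothBdd.sum S fun l _ => ?_
    exact SmoothBdd.bilinear (ContinuousLinearMap.smulRightL ℝ (Ec d) (Ec d))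
      (SmoothBdd.bilinear (ContinuousLinearMap.id ℝ (Ec d →L[ℝ] Ec d →L[ℝ] ℝ))
        (SmoothBdd.const I) (hA' l)) (hA' l)
  have hlow : ∀ x y, σ * ‖y‖ ≤ ‖T x y‖ := by
    intro x y
    rcases eq_or_ne y 0 with rfl | hy
    · simp
    · have h1 : ⟪T x y, y⟫ = ∑ l ∈ S, ⟪A l x, y⟫ ^ 2 := by
        rw [hTapp, sum_inner]
        simp only [real_inner_smul_left, sq]
      have h2 := (h x y).trans (h1 ▸ real_inner_le_norm (T x y) y)
      have hy' := norm_pos_iff.2 hy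
      nlinarith
  have hunit : ∀ x, IsUnit (T x) := by
    intro x
    rw [ContinuousLinearMap.isUnit_iff_bijective]
    have hinj : Function.Injective (T x) := by
      rw [injective_iff_map_eq_zero]
      intro y hy
      have := hlow x y
      rw [hy, norm_zero] at this
      exact norm_le_zero_iff.1 (by nlinarith [norm_nonneg y])
    exact ⟨hinj, LinearMap.injective_iff_surjective (f := (T x : Ec d →ₗ[ℝ] Ec d)).1 hinj⟩
  have hTinv : ∀ x y, T x (Ring.inverse (T x) y) = y := fun x y => by
    rw [← mul_apply_eq_comp, Ring.mul_inverse_cancel _ (hunit x),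
      one_apply_eq_self]
  have hinv : SmoothBdd (fun x => Ring.inverse (T x)) := by
    refine hT.ringInverse hunit (C := 1 / σ) fun x => ?_
    refine ContinuousLinearMap.opNorm_le_bound _ (by positivity) fun y => ?_
    have := hlow x (Ring.inverse (T x) y)
    rw [hTinv] at this
    rw [one_div_mul_eq_div, le_div_iff₀' hσ]
    exact this
  refine ⟨fun l x => ⟪A l x, Ring.inverse (T x) (a x)⟫, fun l => ?_, fun x => ?_⟩
  · exact SmoothBdd.bilinear I (hA' l)
      (SmoothBdd.bilinear (ContinuousLinearMap.id ℝ (Ec d →L[ℝ] Ec d)) hinv ha')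
  · rw [← hTapp, hTinv]

lemma exists_colDet_lower_bound_of_bounded_coeffs
    (h : ∃ M : ℝ, 0 < M ∧ ∀ (x : Ec d) (i : Fin d), ∃ c : ι → ℝ, (∀ l, |c l| ≤ M) ∧
      (EuclideanSpace.single i 1 : Ec d) = ∑ l ∈ S, c l • A l x) :
    ∃ σ : ℝ, 0 < σ ∧ ∀ x, ∃ β : Fin d → ι, (∀ i, β i ∈ S) ∧
      σ ≤ |colDet fun i => A (β i) x| := by
  classical
  obtain ⟨M, hM, h⟩ := h
  refine ⟨1 / (S.card ^ d * M ^ d + 1), by positivity, fun x => ?_⟩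
  choose c hc hsum using h x
  by_contra! hcon
  set σ : ℝ := 1 / (S.card ^ d * M ^ d + 1) with hσ
  have hσ0 : 0 < σ := by positivity
  have h1 := one_eq_sum_prod_mul_colDet S (fun l => A l x) c hsum
  have h2 : (1 : ℝ) ≤ ∑ _β ∈ Fintype.piFinset (fun _ : Fin d => S), M ^ d * σ := by
    rw [h1]
    refine (le_abs_self _).trans ((Finset.abs_sum_le_sum_abs _ _).trans
      (Finset.sum_le_sum fun β hβ => ?_))
    rw [abs_mul, Finset.abs_prod]
    refine mul_le_mul ?_ (hcon β (by simpa using hβ)).le (abs_nonneg _) (by positivity)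
    refine (Finset.prod_le_prod (fun _ _ => abs_nonneg _) fun i _ => hc i (β i)).trans ?_
    simp
  rw [Finset.sum_const, Fintype.card_piFinset_const, nsmul_eq_mul, ← mul_assoc, hσ,
    mul_one_div, le_div_iff₀ (by positivity)] at h2
  push_cast at h2
  linarith

lemma exists_bounded_coeffs_of_colDet_lower_bound (hA : ∀ l, IsCbVF (A l))
    (h : ∃ σ : ℝ, 0 < σ ∧ ∀ x, ∃ β : Fin d → ι, (∀ i, β i ∈ S) ∧
      σ ≤ |colDet fun i => A (β i) x|) :
    ∃ M : ℝ, 0 < M ∧ ∀ (x : Ec d) (i : Fin d), ∃ c : ι → ℝ, (∀ l, |c l| ≤ M) ∧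
      (EuclideanSpace.single i 1 : Ec d) = ∑ l ∈ S, c l • A l x := by
  obtain ⟨σ, hσ, h⟩ := h
  choose C hC using fun l => SmoothBdd.exists_norm_le (hA l)
  have hC0 : ∀ l, 0 ≤ C l := fun l => (norm_nonneg _).trans (hC l 0)
  have hs0 : 0 ≤ ∑ l ∈ S, C l := Finset.sum_nonneg fun l _ => hC0 l
  set K : ℝ := (∑ l ∈ S, C l) + 1 with hK
  have hK0 : 0 < K := by linarith
  have hAK : ∀ l ∈ S, ∀ x, ‖A l x‖ ≤ K := fun l hl x => by
    have := Finset.single_le_sum (f := C) (fun l _ => hC0 l) hl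
    linarith [hC l x]
  refine ⟨d * (d.factorial * K ^ d / σ) + 1, by positivity, fun x k => ?_⟩
  obtain ⟨β, hβ, hdet⟩ := h x
  have hpos : 0 < |colDet fun i => A (β i) x| := hσ.trans_le hdet
  have hrep := eq_sum_colDet_update_smul (fun i => A (β i) x) (abs_pos.1 hpos)
    (EuclideanSpace.single k 1)
  obtain ⟨c, hc, hsum⟩ := exists_sum_smul_of_subfamily S (fun l => A l x) β hβ
    (fun i => colDet (Function.update (fun i => A (β i) x) i (EuclideanSpace.single k 1)) /
      colDet fun i => A (β i) x) (M := d * (d.factorial * K ^ d / σ) + 1) (by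
    refine (Finset.sum_le_sum (g := fun _ => d.factorial * K ^ d / σ) fun i _ => ?_).trans
      (by simp)
    rw [abs_div]
    refine div_le_div₀ (by positivity) (abs_colDet_le _ fun j => ?_) hσ hdet
    by_cases hj : j = i
    · subst hj
      simp [hK, hs0]
    · simpa [hj] using hAK _ (hβ j) x)
  exact ⟨c, hc, hrep.trans hsum⟩

lemma exists_volume_lower_bound_of_colDet_lower_bound
    (h : ∃ σ : ℝ, 0 < σ ∧ ∀ x, ∃ β : Fin d → ι, (∀ i, β i ∈ S) ∧
      σ ≤ |colDet fun i => A (β i) x|) :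
    ∃ σ : ℝ, 0 < σ ∧ ∀ x, ENNReal.ofReal σ ≤ volume (zonotope S fun l => A l x) := by
  obtain ⟨σ, hσ, h⟩ := h
  have hfin : volume (Metric.closedBall (0 : Ec d) (1 / (d + 1))) ≠ ⊤ :=
    measure_closedBall_lt_top.ne
  have hpos : 0 < volume (Metric.closedBall (0 : Ec d) (1 / (d + 1))) :=
    Metric.measure_closedBall_pos _ _ (by positivity)
  refine ⟨σ * (volume (Metric.closedBall (0 : Ec d) (1 / (d + 1)))).toReal,
    mul_pos hσ (ENNReal.toReal_pos hpos.ne' hfin), fun x => ?_⟩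
  obtain ⟨β, hβ, hdet⟩ := h x
  refine le_trans ?_ (ofReal_abs_colDet_mul_le_volume_zonotope S (fun l => A l x) β hβ)
  rw [ENNReal.ofReal_mul hσ.le, ENNReal.ofReal_toReal hfin]
  gcongr

lemma exists_colDet_lower_bound_of_volume_lower_bound
    (h : ∃ σ : ℝ, 0 < σ ∧ ∀ x, ENNReal.ofReal σ ≤ volume (zonotope S fun l => A l x)) :
    ∃ σ : ℝ, 0 < σ ∧ ∀ x, ∃ β : Fin d → ι, (∀ i, β i ∈ S) ∧
      σ ≤ |colDet fun i => A (β i) x| := by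
  obtain ⟨σ, hσ, h⟩ := h
  set q := volume (Metric.closedBall (0 : Ec d) √(d * (S.card : ℝ) ^ 2)) with hq
  have hfin : q ≠ ⊤ := measure_closedBall_lt_top.ne
  refine ⟨σ / (q.toReal + 1), by positivity, fun x => ?_⟩
  obtain ⟨β, hβ, hvol⟩ := exists_volume_zonotope_le S (fun l => A l x)
    ((ENNReal.ofReal_pos.2 hσ).trans_le (h x))
  refine ⟨β, hβ, ?_⟩
  have h1 := (h x).trans hvol
  rw [← hq, ← ENNReal.ofReal_toReal hfin, ← ENNReal.ofReal_mul (abs_nonneg _),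
    ENNReal.ofReal_le_ofReal_iff (by positivity)] at h1
  rw [div_le_iff₀ (by positivity)]
  linarith [abs_nonneg (colDet fun i => A (β i) x)]

end Families

/-- The multi-indices over `Fin N` of length between `1` and `r`. -/
def multiIndices (N r : ℕ) : Finset (List (Fin N)) :=
  (Finset.Icc 1 r).biUnion fun k => (Finset.univ : Finset (Fin k → Fin N)).image List.ofFn

lemma mem_multiIndices {N r : ℕ} {l : List (Fin N)} :
    l ∈ multiIndices N r ↔ 1 ≤ l.length ∧ l.length ≤ r := by
  simp only [multiIndices, Finset.mem_biUnion, Finset.mem_Icc, Finset.mem_image,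
    Finset.mem_univ, true_and]
  constructor
  · rintro ⟨k, hk, v, rfl⟩
    simpa using hk
  · exact fun h => ⟨l.length, h, l.get, List.ofFn_get l⟩

lemma sum_Icc_sum_ofFn {N r : ℕ} {V : Type*} [AddCommMonoid V] (f : List (Fin N) → V) :
    ∑ k ∈ Finset.Icc 1 r, ∑ v : Fin k → Fin N, f (List.ofFn v) = ∑ l ∈ multiIndices N r, f l := by
  rw [multiIndices, Finset.sum_biUnion]
  · refine Finset.sum_congr rfl fun k _ => ?_
    rw [Finset.sum_image fun v _ w _ hvw => List.ofFn_injective hvw]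
  · intro k _ m _ hkm
    rw [Function.onFun, Finset.disjoint_left]
    intro l hl hl'
    simp only [Finset.mem_image, Finset.mem_univ, true_and] at hl hl'
    obtain ⟨v, rfl⟩ := hl
    obtain ⟨w, hw⟩ := hl'
    exact hkm (by simpa using (congrArg List.length hw).symm)

lemma sum_Cmat_mul_mul {N r : ℕ} (X : Fin N → Ec d → Ec d) (x ξ : Ec d) :
    ∑ i, ∑ j, Cmat X r x i j * ξ i * ξ j =
      ∑ l ∈ multiIndices N r, ⟪multiComm X l x, ξ⟫ ^ 2 := by
  have h : ∀ i j, Cmat X r x i j =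
      ∑ l ∈ multiIndices N r, multiComm X l x i * multiComm X l x j := fun i j =>
    sum_Icc_sum_ofFn fun l => multiComm X l x i * multiComm X l x j
  simp only [h, Finset.sum_mul]
  calc _ = ∑ i, ∑ l ∈ multiIndices N r, ∑ j,
        multiComm X l x i * multiComm X l x j * ξ i * ξ j :=
        Finset.sum_congr rfl fun i _ => Finset.sum_comm
    _ = ∑ l ∈ multiIndices N r, ∑ i, ∑ j,
        multiComm X l x i * multiComm X l x j * ξ i * ξ j := Finset.sum_comm
    _ = _ := Finset.sum_congr rfl fun l _ => by
        rw [PiLp.inner_apply, sq, Finset.sum_mul_sum]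
        refine Finset.sum_congr rfl fun i _ => Finset.sum_congr rfl fun j _ => ?_
        simp only [RCLike.inner_apply, conj_trivial]
        ring

/-- **Proposition 5.1 of ter Elst–Robinson, "Uniform subellipticity".**
For `C_b^∞`-vector fields `X₁,…,X_N` on `ℝ^d` the following are equivalent:
(I) the uniform Hörmander condition of order `r`;
(II) a uniform lower bound `C^{(r)}(x) ≥ σI > 0`;
(III) each unit vector `e_i` is a linear combination `∑_α λ_α a_α(x)` with uniformly
bounded coefficients;
(IV) a uniform lower bound on the volume of the zonotope
`{∑_α λ_α a_α(x) : |λ_α| ≤ 1}`;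
(V) a uniform lower bound `|det(a_{α₁}(x),…,a_{α_d}(x))| ≥ σ` for a suitable choice of
multi-indices `α₁,…,α_d ∈ J_r^+(N)` depending on `x`. -/
theorem uniform_hormander_characterisations (d N r : ℕ) (hr : 1 ≤ r)
    (X : Fin N → Ec d → Ec d) (hX : ∀ i, IsCbVF (X i)) :
    List.TFAE [
      -- (I) uniform Hörmander condition of order r
      UniformHormander X r,
      -- (II) C^{(r)}(x) ≥ σ I uniformly in x
      ∃ σ : ℝ, 0 < σ ∧ ∀ (x ξ : Ec d),
        σ * ‖ξ‖ ^ 2 ≤ ∑ i, ∑ j, Cmat X r x i j * ξ i * ξ j,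
      -- (III) uniformly bounded representation of the unit vectors
      ∃ M : ℝ, 0 < M ∧ ∀ (x : Ec d) (i : Fin d),
        ∃ lam : List (Fin N) → ℝ, (∀ l, |lam l| ≤ M) ∧
          (EuclideanSpace.single i 1 : Ec d) =
            ∑ k ∈ Finset.Icc 1 r, ∑ v : Fin k → Fin N,
              lam (List.ofFn v) • multiComm X (List.ofFn v) x,
      -- (IV) uniform lower bound for the volume of the zonotope
      ∃ σ : ℝ, 0 < σ ∧ ∀ x : Ec d,
        ENNReal.ofReal σ ≤
          volume {y : Ec d | ∃ lam : List (Fin N) → ℝ, (∀ l, |lam l| ≤ 1) ∧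
            y = ∑ k ∈ Finset.Icc 1 r, ∑ v : Fin k → Fin N,
              lam (List.ofFn v) • multiComm X (List.ofFn v) x},
      -- (V) uniform lower bound on a subdeterminant
      ∃ σ : ℝ, 0 < σ ∧ ∀ x : Ec d,
        ∃ β : Fin d → List (Fin N),
          (∀ i, 1 ≤ (β i).length ∧ (β i).length ≤ r) ∧
          σ ≤ |(Matrix.of fun i j : Fin d => multiComm X (β j) x i).det| ] := by
  have hA : ∀ l, IsCbVF (multiComm X l) := IsCbVF.multiComm hX
  simp only [UniformHormander, sum_Cmat_mul_mul]
  have hsum : ∀ (c : List (Fin N) → ℝ) (x : Ec d),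
      ∑ k ∈ Finset.Icc 1 r, ∑ v : Fin k → Fin N,
        c (List.ofFn v) • multiComm X (List.ofFn v) x =
      ∑ l ∈ multiIndices N r, c l • multiComm X l x := fun c x =>
    sum_Icc_sum_ofFn fun l => c l • multiComm X l x
  have hsum' : ∀ (ψ : List (Fin N) → Ec d → ℝ) (x : Ec d),
      ∑ k ∈ Finset.Icc 1 r, ∑ v : Fin k → Fin N,
        ψ (List.ofFn v) x • multiComm X (List.ofFn v) x =
      ∑ l ∈ multiIndices N r, ψ l x • multiComm X l x := fun ψ x => hsum (fun l => ψ l x) x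
  simp only [hsum, hsum', ← mem_multiIndices]
  tfae_have 1 → 3 := exists_bounded_coeffs_of_hormander _ _
  tfae_have 3 → 2 := exists_gram_lower_bound_of_bounded_coeffs _ _
  tfae_have 2 → 1 := hormander_of_gram_lower_bound _ _ hA
  tfae_have 3 → 5 := exists_colDet_lower_bound_of_bounded_coeffs _ _
  tfae_have 5 → 3 := exists_bounded_coeffs_of_colDet_lower_bound _ _ hA
  tfae_have 5 → 4 := exists_volume_lower_bound_of_colDet_lower_bound _ _
  tfae_have 4 → 5 := exists_colDet_lower_bound_of_volume_lower_bound _ _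
  tfae_finish

end
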